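/- Let P, Q be Borel probability measures on ℝ^d satisfying the continuity assumption, and let ϑ ∈ (0,1). Then W_d²(P,Q) = 1/3 − (1/(2π)) ∫∫∫ Ang(x1 − y, x2 − y) dP(x1) dP(x2) dQ(y) − (1/(2π)) ∫∫∫ Ang(y1 − x, y2 − x) dQ(y1) dQ(y2) dP(x), where the integrands are defined almost everywhere (the difference vectors are nonzero almost surely under the continuity assumption). In particular, W_d²(P,Q) does not depend on the choice of ϑ. -/

import Mathlib

open MeasureTheory ProbabilityTheory Real
open scoped RealInnerProductSpace ENNReal BigOperators

noncomputable section

/-- The standard Gaussian measure on `ℝ^d = EuclideanSpace ℝ (Fin d)`. -/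
def stdGaussian (d : ℕ) : Measure (EuclideanSpace ℝ (Fin d)) :=
  (Measure.pi fun _ : Fin d => gaussianReal 0 1).map
    ⇑(EuclideanSpace.equiv (Fin d) ℝ).symm

/-- The uniform (rotation-invariant) probability measure `λ` on the unit sphere
`S^{d-1} = {x : ‖x‖ = 1} ⊆ ℝ^d`, realized as a Borel measure on `ℝ^d` concentrated
on the sphere: the pushforward of the standard Gaussian under `x ↦ ‖x‖⁻¹ • x`. -/
def sphereUniform (d : ℕ) : Measure (EuclideanSpace ℝ (Fin d)) :=
  (stdGaussian d).map fun x => ‖x‖⁻¹ • x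

/-- `Ang u v = arccos (⟪u,v⟫ / (‖u‖ ‖v‖)) ∈ [0, π]`, the angle between two nonzero vectors. -/
def Ang {d : ℕ} (u v : EuclideanSpace ℝ (Fin d)) : ℝ :=
  Real.arccos (⟪u, v⟫ / (‖u‖ * ‖v‖))

/-- Law of the projection `x ↦ ⟪β, x⟫` under `P`. -/
def projLaw {d : ℕ} (P : Measure (EuclideanSpace ℝ (Fin d)))
    (β : EuclideanSpace ℝ (Fin d)) : Measure ℝ :=
  P.map fun x => ⟪β, x⟫

/-- `F_{β,P}(t) = P {x : ⟪β,x⟫ ≤ t}`. -/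
def projCDF {d : ℕ} (P : Measure (EuclideanSpace ℝ (Fin d)))
    (β : EuclideanSpace ℝ (Fin d)) (t : ℝ) : ℝ :=
  (P {x | ⟪β, x⟫ ≤ t}).toReal

/-- The squared Cramér–von Mises distance `W_d²(P,Q)` with weight `ϑ`:
`∫_{S^{d-1}} ∫_ℝ (F_{β,P}(t) - F_{β,Q}(t))² dH_β(t) dλ(β)` where `H_β` is the law of
`x ↦ ⟪β,x⟫` under the mixture `ϑ•P + (1-ϑ)•Q`. -/
def cvmSq {d : ℕ} (ϑ : ℝ) (P Q : Measure (EuclideanSpace ℝ (Fin d))) : ℝ :=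
  ∫ β, (∫ t, (projCDF P β t - projCDF Q β t) ^ 2
      ∂(projLaw (ENNReal.ofReal ϑ • P + ENNReal.ofReal (1 - ϑ) • Q) β))
    ∂(sphereUniform d)

/-- The continuity assumption: for `λ`-a.e. `β`, the pushforwards of `P` and `Q`
under `x ↦ ⟪β,x⟫` are atomless. -/
def ContinuityAssumption {d : ℕ} (P Q : Measure (EuclideanSpace ℝ (Fin d))) : Prop :=
  ∀ᵐ β ∂(sphereUniform d),
    (∀ t : ℝ, projLaw P β {t} = 0) ∧ (∀ t : ℝ, projLaw Q β {t} = 0)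

lemma gauss2_polar (B : Set (ℝ × ℝ)) (hB : MeasurableSet B) (T : Set ℝ) (hT : MeasurableSet T)
    (h : ∀ r : ℝ, 0 < r → ∀ φ ∈ Set.Ioo (-π) π, ((r * cos φ, r * sin φ) ∈ B ↔ φ ∈ T)) :
    ((gaussianReal 0 1).prod (gaussianReal 0 1)) B
      = (∫⁻ r in Set.Ioi (0:ℝ), ENNReal.ofReal (r * ((2 * π)⁻¹ * rexp (- r ^ 2 / 2))))
        * volume (T ∩ Set.Ioo (-π) π) := by
  have hm : Measurable (fun z : ℝ × ℝ => gaussianPDF 0 1 z.1 * gaussianPDF 0 1 z.2) :=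
    ((measurable_gaussianPDF 0 1).comp measurable_fst).mul
      ((measurable_gaussianPDF 0 1).comp measurable_snd)
  rw [gaussianReal_of_var_ne_zero _ one_ne_zero,
    prod_withDensity (measurable_gaussianPDF 0 1) (measurable_gaussianPDF 0 1),
    withDensity_apply _ hB, ← lintegral_indicator hB]
  change ∫⁻ (a : ℝ × ℝ), _ ∂volume = _
  rw [← lintegral_comp_polarCoord_symm]
  have e : ∀ p ∈ polarCoord.target, ENNReal.ofReal p.1 • B.indicator
        (fun a : ℝ × ℝ => gaussianPDF 0 1 a.1 * gaussianPDF 0 1 a.2) (polarCoord.symm p)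
      = (fun r : ℝ => ENNReal.ofReal (r * ((2 * π)⁻¹ * rexp (- r ^ 2 / 2)))) p.1
        * (T.indicator (fun _ => (1 : ℝ≥0∞))) p.2 := by
    rintro ⟨r, φ⟩ hp
    rw [polarCoord_target] at hp
    obtain ⟨hr, hφ⟩ := hp
    simp only [Set.mem_Ioi] at hr
    have := h r hr φ hφ
    simp only [polarCoord_symm_apply]
    by_cases hT' : φ ∈ T
    · rw [Set.indicator_of_mem (this.2 hT'), Set.indicator_of_mem hT']
      simp only [gaussianPDF_def, gaussianPDFReal_def, smul_eq_mul, mul_one]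
      rw [← ENNReal.ofReal_mul (by positivity), ← ENNReal.ofReal_mul hr.le]
      congr 2
      have h1 : (√(2 * π * ((1:NNReal):ℝ)))⁻¹ * (√(2 * π * ((1:NNReal):ℝ)))⁻¹ = (2 * π)⁻¹ := by
        rw [← mul_inv, Real.mul_self_sqrt (by positivity)]; simp
      rw [mul_mul_mul_comm, h1, ← Real.exp_add]
      congr 2
      have := Real.sin_sq_add_cos_sq φ
      simp only [sub_zero, NNReal.coe_one]
      linear_combination (-r^2/2) * this
    · rw [Set.indicator_of_notMem (fun hh => hT' (this.1 hh)), Set.indicator_of_notMem hT']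
      simp
  rw [setLIntegral_congr_fun (by rw [polarCoord_target]; exact measurableSet_Ioi.prod measurableSet_Ioo) e,
    polarCoord_target]
  change ∫⁻ p in _, _ ∂((volume : Measure ℝ).prod volume) = _
  rw [← Measure.prod_restrict, lintegral_prod_mul
    (f := fun r : ℝ => ENNReal.ofReal (r * ((2 * π)⁻¹ * rexp (- r ^ 2 / 2))))
    (Measurable.aemeasurable (by fun_prop))
    (g := T.indicator (fun _ => (1 : ℝ≥0∞))) ((measurable_const.indicator hT).aemeasurable),
    lintegral_indicator_const hT, Measure.restrict_apply hT, one_mul]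

lemma gauss2_wedge (B : Set (ℝ × ℝ)) (hB : MeasurableSet B) (T : Set ℝ) (hT : MeasurableSet T)
    (h : ∀ r : ℝ, 0 < r → ∀ φ ∈ Set.Ioo (-π) π, ((r * cos φ, r * sin φ) ∈ B ↔ φ ∈ T)) :
    ((gaussianReal 0 1).prod (gaussianReal 0 1)).real B
      = (2 * π)⁻¹ * volume.real (T ∩ Set.Ioo (-π) π) := by
  have h1 := gauss2_polar B hB T hT h
  have h2 := gauss2_polar Set.univ MeasurableSet.univ Set.univ MeasurableSet.univ (by simp)
  rw [measure_univ, Set.univ_inter, Real.volume_Ioo] at h2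
  have h3 := congrArg ENNReal.toReal h1
  have h4 := congrArg ENNReal.toReal h2
  rw [ENNReal.toReal_mul] at h3 h4
  rw [ENNReal.toReal_ofReal (by linarith [pi_pos]), ENNReal.toReal_one] at h4
  rw [measureReal_def, h3, measureReal_def]
  congr 1
  have := pi_pos
  apply eq_inv_of_mul_eq_one_left
  rw [h4]
  ring

lemma stdG_eq (d : ℕ) : _root_.stdGaussian d
    = ProbabilityTheory.stdGaussian (EuclideanSpace ℝ (Fin d)) := by
  rw [← map_pi_eq_stdGaussian]; rfl

lemma cos_Ang {d : ℕ} (u v : EuclideanSpace ℝ (Fin d)) (hu : u ≠ 0) (hv : v ≠ 0) :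
    ⟪u, v⟫ = ‖u‖ * ‖v‖ * cos (Ang u v) := by
  have := InnerProductGeometry.cos_angle u v
  unfold InnerProductGeometry.angle at this
  rw [Ang, this]
  have : ‖u‖ ≠ 0 := by simpa
  have : ‖v‖ ≠ 0 := by simpa
  field_simp

lemma gauss_pair {d : ℕ} (u v : EuclideanSpace ℝ (Fin d)) (hu : u ≠ 0) (hv : v ≠ 0) :
    (ProbabilityTheory.stdGaussian (EuclideanSpace ℝ (Fin d))).map
        (fun β => ((⟪β, u⟫ : ℝ), (⟪β, v⟫ : ℝ)))
      = ((gaussianReal 0 1).prod (gaussianReal 0 1)).map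
        (fun p : ℝ × ℝ => (‖u‖ * (cos (Ang u v / 2) * p.1 + sin (Ang u v / 2) * p.2),
          ‖v‖ * (cos (Ang u v / 2) * p.1 - sin (Ang u v / 2) * p.2))) := by
  have : IsProbabilityMeasure ((ProbabilityTheory.stdGaussian (EuclideanSpace ℝ (Fin d))).map
        (fun β => ((⟪β, u⟫ : ℝ), (⟪β, v⟫ : ℝ)))) :=
    Measure.isProbabilityMeasure_map (by fun_prop)
  have : IsProbabilityMeasure (((gaussianReal 0 1).prod (gaussianReal 0 1)).map
        (fun p : ℝ × ℝ => (‖u‖ * (cos (Ang u v / 2) * p.1 + sin (Ang u v / 2) * p.2),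
          ‖v‖ * (cos (Ang u v / 2) * p.1 - sin (Ang u v / 2) * p.2)))) :=
    Measure.isProbabilityMeasure_map (by fun_prop)
  apply Measure.ext_of_charFunDual
  ext L
  have hL : ∀ x y : ℝ, L (x, y) = x * L (1, 0) + y * L (0, 1) := by
    intro x y
    have : ((x, y) : ℝ × ℝ) = x • (1, 0) + y • (0, 1) := by simp
    rw [this, map_add, map_smul, map_smul]; simp
  set s := L (1, 0)
  set t := L (0, 1)
  set c := cos (Ang u v / 2) with hc
  set k := sin (Ang u v / 2) with hk
  have e1 : charFunDual ((ProbabilityTheory.stdGaussian (EuclideanSpace ℝ (Fin d))).map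
        (fun β => ((⟪β, u⟫ : ℝ), (⟪β, v⟫ : ℝ)))) L
      = Complex.exp (- ‖s • u + t • v‖ ^ 2 / 2) := by
    rw [← charFun_stdGaussian, charFunDual_apply, charFun_apply,
      integral_map (by fun_prop) (Measurable.aestronglyMeasurable (by fun_prop))]
    congr with β
    rw [hL, inner_add_right, inner_smul_right, inner_smul_right, mul_comm s, mul_comm t]
  have e2 : charFunDual (((gaussianReal 0 1).prod (gaussianReal 0 1)).map
        (fun p : ℝ × ℝ => (‖u‖ * (c * p.1 + k * p.2), ‖v‖ * (c * p.1 - k * p.2)))) L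
      = Complex.exp (- (((s * ‖u‖ + t * ‖v‖) * c : ℝ)) ^ 2 / 2)
        * Complex.exp (- (((s * ‖u‖ - t * ‖v‖) * k : ℝ)) ^ 2 / 2) := by
    have g : ∀ t : ℝ, ∫ x, Complex.exp (t * x * Complex.I) ∂(gaussianReal 0 1)
        = Complex.exp (- (t : ℂ) ^ 2 / 2) := by
      intro t
      rw [← charFun_apply_real, charFun_gaussianReal]
      simp [neg_div]
    rw [charFunDual_apply,
      integral_map (by fun_prop) (Measurable.aestronglyMeasurable (by fun_prop)),
      ← g, ← g, ← integral_prod_mul]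
    congr with p
    rw [hL, ← Complex.exp_add]
    congr 1
    push_cast
    ring
  rw [e1, e2, ← Complex.exp_add]
  congr 1
  have h1 : ‖s • u + t • v‖ ^ 2 = ((s * ‖u‖ + t * ‖v‖) * c) ^ 2 + ((s * ‖u‖ - t * ‖v‖) * k) ^ 2 := by
    rw [norm_add_sq_real, inner_smul_left, inner_smul_right, norm_smul, norm_smul,
      cos_Ang u v hu hv, mul_pow, mul_pow, Real.norm_eq_abs, Real.norm_eq_abs, sq_abs, sq_abs]
    have h2 : cos (Ang u v) = c ^ 2 - k ^ 2 := by
      rw [hc, hk, ← Real.cos_two_mul']; congr 1; ring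
    have h3 : c ^ 2 + k ^ 2 = 1 := by rw [hc, hk]; exact Real.cos_sq_add_sin_sq _
    rw [h2]
    simp only [conj_trivial]
    linear_combination (-s ^ 2 * ‖u‖ ^ 2 - t ^ 2 * ‖v‖ ^ 2) * h3
  have h1' : (‖s • u + t • v‖ : ℂ) ^ 2 = ((((s * ‖u‖ + t * ‖v‖) * c : ℝ)) : ℂ) ^ 2
      + ((((s * ‖u‖ - t * ‖v‖) * k : ℝ)) : ℂ) ^ 2 := by exact_mod_cast congrArg Complex.ofReal h1
  rw [h1']; ring

lemma cos_nonpos_iff_aux (x : ℝ) (h1 : -(3 * π / 2) < x) (h2 : x < 3 * π / 2) :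
    0 ≤ cos x ↔ -(π / 2) ≤ x ∧ x ≤ π / 2 := by
  constructor
  · intro h
    by_contra hh
    rw [not_and_or, not_le, not_le] at hh
    rcases hh with hh | hh
    · have := Real.cos_neg_of_pi_div_two_lt_of_lt (x := -x) (by linarith) (by linarith)
      rw [Real.cos_neg] at this; linarith
    · have := Real.cos_neg_of_pi_div_two_lt_of_lt (x := x) (by linarith) (by linarith)
      linarith
  · rintro ⟨h1, h2⟩
    exact Real.cos_nonneg_of_mem_Icc ⟨by linarith, h2⟩

/-- quadrant probability -/
lemma sphere_wedge {d : ℕ} (u v : EuclideanSpace ℝ (Fin d)) (hu : u ≠ 0) (hv : v ≠ 0) :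
    (sphereUniform d).real {β | ⟪β, u⟫ ≤ 0 ∧ ⟪β, v⟫ ≤ 0} = 1 / 2 - 1 / (2 * π) * Ang u v := by
  have hu' : 0 < ‖u‖ := by simpa
  have hv' : 0 < ‖v‖ := by simpa
  have hms : MeasurableSet {β : EuclideanSpace ℝ (Fin d) | ⟪β, u⟫ ≤ 0 ∧ ⟪β, v⟫ ≤ 0} := by
    apply MeasurableSet.inter (s₁ := {β | ⟪β, u⟫ ≤ 0}) (s₂ := {β | ⟪β, v⟫ ≤ 0})
    · exact measurableSet_le (by fun_prop) (by fun_prop)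
    · exact measurableSet_le (by fun_prop) (by fun_prop)
  have hQ : MeasurableSet {p : ℝ × ℝ | 0 ≤ p.1 ∧ 0 ≤ p.2} := by
    apply MeasurableSet.inter (s₁ := {p : ℝ × ℝ | 0 ≤ p.1}) (s₂ := {p : ℝ × ℝ | 0 ≤ p.2})
    · exact measurableSet_le (by fun_prop) (by fun_prop)
    · exact measurableSet_le (by fun_prop) (by fun_prop)
  have e1 : (sphereUniform d).real {β | ⟪β, u⟫ ≤ 0 ∧ ⟪β, v⟫ ≤ 0}
      = (_root_.stdGaussian d).real {β | ⟪β, u⟫ ≤ 0 ∧ ⟪β, v⟫ ≤ 0} := by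
    rw [sphereUniform, map_measureReal_apply (by fun_prop) hms]
    congr 1
    ext x
    by_cases hx : x = 0
    · simp [hx]
    · have : 0 < ‖x‖⁻¹ := by simpa
      simp only [Set.mem_preimage, Set.mem_ofPred_eq, inner_smul_left, conj_trivial,
        mul_nonpos_iff_pos_imp_nonpos, this]
      simp [this.le]
  have e2 : {β : EuclideanSpace ℝ (Fin d) | ⟪β, u⟫ ≤ 0 ∧ ⟪β, v⟫ ≤ 0}
      = (fun β => ((⟪β, -u⟫ : ℝ), (⟪β, -v⟫ : ℝ))) ⁻¹' {p : ℝ × ℝ | 0 ≤ p.1 ∧ 0 ≤ p.2} := by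
    ext; simp
  have e3 : Ang (-u) (-v) = Ang u v := by simp [Ang]
  rw [e1, stdG_eq, e2, ← map_measureReal_apply (by fun_prop) hQ,
    gauss_pair (-u) (-v) (by simpa) (by simpa), map_measureReal_apply (by fun_prop) hQ, e3,
    norm_neg, norm_neg]
  have hA0 : 0 ≤ Ang u v := Real.arccos_nonneg _
  have hA1 : Ang u v ≤ π := Real.arccos_le_pi _
  set θ := Ang u v
  rw [gauss2_wedge _ (hQ.preimage (by fun_prop)) (Set.Icc (-(π / 2 - θ / 2)) (π / 2 - θ / 2))
    measurableSet_Icc]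
  · have : (2 * π)⁻¹ * (π - θ) = 1 / 2 - 1 / (2 * π) * θ := by field_simp
    rw [← this]; congr 1
    have hp := pi_pos
    rw [Set.inter_eq_left.2, measureReal_def, Real.volume_Icc, ENNReal.toReal_ofReal]
    · ring
    · linarith
    · intro x hx; constructor <;> [linarith [hx.1]; linarith [hx.2]]
  · intro r hr φ hφ
    obtain ⟨h1, h2⟩ := hφ
    have i1 : ‖u‖ * (cos (θ / 2) * (r * cos φ) + sin (θ / 2) * (r * sin φ))
        = (‖u‖ * r) * cos (φ - θ / 2) := by rw [Real.cos_sub]; ring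
    have i2 : ‖v‖ * (cos (θ / 2) * (r * cos φ) - sin (θ / 2) * (r * sin φ))
        = (‖v‖ * r) * cos (φ + θ / 2) := by rw [Real.cos_add]; ring
    simp only [Set.mem_preimage, Set.mem_ofPred_eq, i1, i2, Set.mem_Icc]
    rw [mul_nonneg_iff_of_pos_left (by positivity), mul_nonneg_iff_of_pos_left (by positivity),
      cos_nonpos_iff_aux _ (by linarith) (by linarith),
      cos_nonpos_iff_aux _ (by linarith) (by linarith)]
    constructor
    · rintro ⟨⟨a, b⟩, c, e⟩; constructor <;> linarith
    · rintro ⟨a, b⟩; refine ⟨⟨?_, ?_⟩, ?_, ?_⟩ <;> linarith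

lemma ae_ne_pair {α : Type*} [MeasurableSpace α] [MeasurableEq α]
    (μ ν : Measure α) [SFinite ν] [NullSingletonClass ν] :
    ∀ᵐ z ∂(μ.prod ν), z.1 ≠ z.2 := by
  have hm : MeasurableSet {z : α × α | z.1 = z.2} := measurableSet_eq_fun measurable_fst measurable_snd
  rw [ae_iff]
  simp only [ne_eq, not_not]
  rw [Measure.measure_prod_null hm]
  refine Filter.Eventually.of_forall fun x => ?_
  have : Prod.mk x ⁻¹' {z : α × α | z.1 = z.2} = {x} := by ext; simp [eq_comm]
  simp [this]

lemma ae_ne_triple {α : Type*} [MeasurableSpace α] [MeasurableEq α]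
    (μ ν ρ : Measure α) [IsProbabilityMeasure μ] [IsProbabilityMeasure ν] [IsProbabilityMeasure ρ]
    [NullSingletonClass ν] [NullSingletonClass ρ] :
    ∀ᵐ z ∂(μ.prod (ν.prod ρ)), z.1 ≠ z.2.1 ∧ z.1 ≠ z.2.2 ∧ z.2.1 ≠ z.2.2 := by
  have h1 : MeasurePreserving (Prod.map id Prod.fst) (μ.prod (ν.prod ρ)) (μ.prod ν) :=
    (MeasurePreserving.id μ).prod measurePreserving_fst
  have h2 : MeasurePreserving (Prod.map id Prod.snd) (μ.prod (ν.prod ρ)) (μ.prod ρ) :=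
    (MeasurePreserving.id μ).prod measurePreserving_snd
  have h3 : MeasurePreserving Prod.snd (μ.prod (ν.prod ρ)) (ν.prod ρ) := measurePreserving_snd
  filter_upwards [h1.quasiMeasurePreserving.ae (ae_ne_pair μ ν),
    h2.quasiMeasurePreserving.ae (ae_ne_pair μ ρ),
    h3.quasiMeasurePreserving.ae (ae_ne_pair ν ρ)] with z a b c
  exact ⟨a, b, c⟩

lemma triple_lintegral (μ ν ρ : Measure ℝ) [IsProbabilityMeasure μ] [IsProbabilityMeasure ν]
    [IsProbabilityMeasure ρ] [NullSingletonClass ν] [NullSingletonClass ρ] :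
    ∫⁻ a, ν (Set.Iic a) * ρ (Set.Iic a) ∂μ + ∫⁻ b, μ (Set.Iic b) * ρ (Set.Iic b) ∂ν
      + ∫⁻ c, μ (Set.Iic c) * ν (Set.Iic c) ∂ρ = 1 := by
  let E1 : Set (ℝ × ℝ × ℝ) := {z | z.2.1 ≤ z.1} ∩ {z | z.2.2 ≤ z.1}
  let E2 : Set (ℝ × ℝ × ℝ) := {z | z.1 ≤ z.2.1} ∩ {z | z.2.2 ≤ z.2.1}
  let E3 : Set (ℝ × ℝ × ℝ) := {z | z.1 ≤ z.2.2} ∩ {z | z.2.1 ≤ z.2.2}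
  have m1 : MeasurableSet E1 := (measurableSet_le (by fun_prop) (by fun_prop)).inter
    (measurableSet_le (by fun_prop) (by fun_prop))
  have m2 : MeasurableSet E2 := (measurableSet_le (by fun_prop) (by fun_prop)).inter
    (measurableSet_le (by fun_prop) (by fun_prop))
  have m3 : MeasurableSet E3 := (measurableSet_le (by fun_prop) (by fun_prop)).inter
    (measurableSet_le (by fun_prop) (by fun_prop))
  have e1 : (μ.prod (ν.prod ρ)) E1 = ∫⁻ a, ν (Set.Iic a) * ρ (Set.Iic a) ∂μ := by
    rw [Measure.prod_apply m1]
    congr with a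
    rw [← Measure.prod_prod]
    congr 1
  have e2 : (μ.prod (ν.prod ρ)) E2 = ∫⁻ b, μ (Set.Iic b) * ρ (Set.Iic b) ∂ν := by
    rw [Measure.prod_apply_symm m2, lintegral_prod _ (measurable_measure_prodMk_right m2).aemeasurable]
    congr with b
    rw [← lintegral_indicator_const measurableSet_Iic]
    congr with c
    by_cases h : c ≤ b
    · rw [Set.indicator_of_mem (by exact h)]
      congr 1; ext a; simp [E2, h]
    · rw [Set.indicator_of_notMem (by exact h)]
      convert measure_empty (μ := μ)
      ext a; simp [E2, h]
  have e3 : (μ.prod (ν.prod ρ)) E3 = ∫⁻ c, μ (Set.Iic c) * ν (Set.Iic c) ∂ρ := by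
    rw [Measure.prod_apply_symm m3,
      lintegral_prod_symm _ (measurable_measure_prodMk_right m3).aemeasurable]
    congr with c
    rw [← lintegral_indicator_const measurableSet_Iic]
    congr with b
    by_cases h : b ≤ c
    · rw [Set.indicator_of_mem (by exact h)]
      congr 1; ext a; simp [E3, h]
    · rw [Set.indicator_of_notMem (by exact h)]
      convert measure_empty (μ := μ)
      ext a; simp [E3, h]
  rw [← e1, ← e2, ← e3, ← lintegral_indicator_one m1, ← lintegral_indicator_one m2,
    ← lintegral_indicator_one m3, ← lintegral_add_left (measurable_one.indicator m1),
    ← lintegral_add_left ((measurable_one.indicator m1).fun_add (measurable_one.indicator m2))]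
  have : ∫⁻ z, (1 : ℝ≥0∞) ∂(μ.prod (ν.prod ρ)) = 1 := by simp
  rw [← this]
  apply lintegral_congr_ae
  filter_upwards [ae_ne_triple μ ν ρ] with z ⟨h1, h2, h3⟩
  obtain ⟨a, b, c⟩ := z
  simp only [Set.indicator_apply, E1, E2, E3, Set.mem_inter_iff, Set.mem_ofPred_eq, Pi.one_apply] at *
  rcases lt_or_gt_of_ne h1 with h1 | h1 <;> rcases lt_or_gt_of_ne h2 with h2 | h2 <;>
  rcases lt_or_gt_of_ne h3 with h3 | h3 <;>
  first
  | (exfalso; linarith)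
  | simp [h1.le, h2.le, h3.le, h1.not_ge, h2.not_ge, h3.not_ge]

lemma meas_Iic (μ : Measure ℝ) : Measurable (fun t => μ (Set.Iic t)) :=
  Monotone.measurable (fun _ _ h => measure_mono (Set.Iic_subset_Iic.2 h))

lemma meas_Iic_real (μ : Measure ℝ) : Measurable (fun t => μ.real (Set.Iic t)) :=
  (meas_Iic μ).ennreal_toReal

lemma int_Iic (μ ν ρ : Measure ℝ) [IsProbabilityMeasure μ] [IsProbabilityMeasure ν]
    [IsProbabilityMeasure ρ] :
    Integrable (fun t => μ.real (Set.Iic t) * ν.real (Set.Iic t)) ρ := by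
  refine Integrable.of_bound ((meas_Iic_real μ).mul (meas_Iic_real ν)).aestronglyMeasurable 1 ?_
  refine Filter.Eventually.of_forall fun t => ?_
  rw [Real.norm_eq_abs, abs_of_nonneg (by positivity)]
  exact mul_le_one₀ measureReal_le_one measureReal_nonneg measureReal_le_one

lemma triple_integral (μ ν ρ : Measure ℝ) [IsProbabilityMeasure μ] [IsProbabilityMeasure ν]
    [IsProbabilityMeasure ρ] [NullSingletonClass ν] [NullSingletonClass ρ] :
    ∫ a, ν.real (Set.Iic a) * ρ.real (Set.Iic a) ∂μ
      + ∫ b, μ.real (Set.Iic b) * ρ.real (Set.Iic b) ∂ν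
      + ∫ c, μ.real (Set.Iic c) * ν.real (Set.Iic c) ∂ρ = 1 := by
  have h := congrArg ENNReal.toReal (triple_lintegral μ ν ρ)
  have key : ∀ (μ ν ρ : Measure ℝ) [IsProbabilityMeasure μ] [IsProbabilityMeasure ν]
    [IsProbabilityMeasure ρ], ∫ a, ν.real (Set.Iic a) * ρ.real (Set.Iic a) ∂μ
      = (∫⁻ a, ν (Set.Iic a) * ρ (Set.Iic a) ∂μ).toReal
      ∧ ∫⁻ a, ν (Set.Iic a) * ρ (Set.Iic a) ∂μ ≠ ∞ := by
    intro μ ν ρ _ _ _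
    constructor
    · rw [← integral_toReal ((meas_Iic ν).fun_mul (meas_Iic ρ)).aemeasurable]
      · simp [measureReal_def]
      · exact Filter.Eventually.of_forall fun t =>
          ENNReal.mul_lt_top (measure_lt_top _ _) (measure_lt_top _ _)
    · refine ne_top_of_le_ne_top ENNReal.one_ne_top ?_
      calc _ ≤ ∫⁻ a, 1 ∂μ := lintegral_mono fun t => mul_le_one' prob_le_one prob_le_one
        _ = 1 := by simp
  rw [ENNReal.toReal_add (ENNReal.add_ne_top.2 ⟨(key _ _ _).2, (key _ _ _).2⟩) (key _ _ _).2,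
    ENNReal.toReal_add (key _ _ _).2 (key _ _ _).2] at h
  rw [(key _ _ _).1, (key _ _ _).1, (key _ _ _).1, h, ENNReal.toReal_one]

lemma oneD (μ ν : Measure ℝ) [IsProbabilityMeasure μ] [IsProbabilityMeasure ν]
    [NullSingletonClass μ] [NullSingletonClass ν] :
    ∫ t, (μ.real (Set.Iic t) - ν.real (Set.Iic t)) ^ 2 ∂μ
      = ∫ t, μ.real (Set.Iic t) ^ 2 ∂ν + ∫ t, ν.real (Set.Iic t) ^ 2 ∂μ - 2 / 3 := by
  have h1 := triple_integral μ μ μ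
  have h2 := triple_integral ν μ μ
  have e : ∫ t, (μ.real (Set.Iic t) - ν.real (Set.Iic t)) ^ 2 ∂μ
      = ∫ t, μ.real (Set.Iic t) * μ.real (Set.Iic t) ∂μ
        - 2 * ∫ t, ν.real (Set.Iic t) * μ.real (Set.Iic t) ∂μ
        + ∫ t, ν.real (Set.Iic t) * ν.real (Set.Iic t) ∂μ := by
    have h4 : Integrable (fun t => μ.real (Set.Iic t) * μ.real (Set.Iic t)
        - 2 * (ν.real (Set.Iic t) * μ.real (Set.Iic t))) μ :=
      Integrable.sub (int_Iic _ _ _) ((int_Iic _ _ _).const_mul _)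
    rw [← integral_const_mul, ← integral_sub (int_Iic _ _ _) ((int_Iic _ _ _).const_mul _),
      ← integral_add h4 (int_Iic _ _ _)]
    congr with t
    ring
  rw [e]
  simp only [pow_two]
  linarith

instance sphere_prob (d : ℕ) : IsProbabilityMeasure (sphereUniform d) := by
  rw [sphereUniform, stdG_eq]
  exact Measure.isProbabilityMeasure_map (Measurable.aemeasurable (by fun_prop))

instance projLaw_prob {d : ℕ} (P : Measure (EuclideanSpace ℝ (Fin d))) [IsProbabilityMeasure P]
    (β : EuclideanSpace ℝ (Fin d)) : IsProbabilityMeasure (projLaw P β) :=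
  Measure.isProbabilityMeasure_map (by fun_prop)

lemma projCDF_eq {d : ℕ} (P : Measure (EuclideanSpace ℝ (Fin d)))
    (β : EuclideanSpace ℝ (Fin d)) (t : ℝ) :
    projCDF P β t = (projLaw P β).real (Set.Iic t) := by
  rw [projLaw, map_measureReal_apply (by fun_prop) measurableSet_Iic]; rfl

lemma inner_eq {d : ℕ} (P Q : Measure (EuclideanSpace ℝ (Fin d)))
    [IsProbabilityMeasure P] [IsProbabilityMeasure Q] (ϑ : ℝ) (hϑ : ϑ ∈ Set.Ioo (0 : ℝ) 1)
    (β : EuclideanSpace ℝ (Fin d))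
    (hP : ∀ t : ℝ, projLaw P β {t} = 0) (hQ : ∀ t : ℝ, projLaw Q β {t} = 0) :
    ∫ t, (projCDF P β t - projCDF Q β t) ^ 2
      ∂(projLaw (ENNReal.ofReal ϑ • P + ENNReal.ofReal (1 - ϑ) • Q) β)
    = ∫ t, projCDF P β t ^ 2 ∂(projLaw Q β) + ∫ t, projCDF Q β t ^ 2 ∂(projLaw P β) - 2 / 3 := by
  have : NullSingletonClass (projLaw P β) := ⟨hP⟩
  have : NullSingletonClass (projLaw Q β) := ⟨hQ⟩
  have hmix : projLaw (ENNReal.ofReal ϑ • P + ENNReal.ofReal (1 - ϑ) • Q) β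
      = ENNReal.ofReal ϑ • projLaw P β + ENNReal.ofReal (1 - ϑ) • projLaw Q β := by
    simp only [projLaw]
    rw [Measure.map_add _ _ (by fun_prop), Measure.map_smul, Measure.map_smul]
  simp only [projCDF_eq]
  have hsqint : ∀ ρ : Measure ℝ, IsProbabilityMeasure ρ → Integrable (fun t =>
      ((projLaw P β).real (Set.Iic t) - (projLaw Q β).real (Set.Iic t)) ^ 2) ρ := by
    intro ρ _
    have := ((int_Iic (projLaw P β) (projLaw P β) ρ).sub
      ((int_Iic (projLaw P β) (projLaw Q β) ρ).const_mul 2)).add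
      (int_Iic (projLaw Q β) (projLaw Q β) ρ)
    refine this.congr (Filter.Eventually.of_forall fun t => ?_)
    simp only [Pi.add_apply, Pi.sub_apply]; ring
  rw [hmix, integral_add_measure ((hsqint _ inferInstance).smul_measure ENNReal.ofReal_ne_top)
    ((hsqint _ inferInstance).smul_measure ENNReal.ofReal_ne_top), integral_smul_measure,
    integral_smul_measure, oneD]
  have h2 := oneD (projLaw Q β) (projLaw P β)
  have h3 : ∫ t, ((projLaw P β).real (Set.Iic t) - (projLaw Q β).real (Set.Iic t)) ^ 2 ∂(projLaw Q β)
    = ∫ t, ((projLaw Q β).real (Set.Iic t) - (projLaw P β).real (Set.Iic t)) ^ 2 ∂(projLaw Q β) := by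
    congr with t; ring
  rw [h3, h2, ENNReal.toReal_ofReal hϑ.1.le, ENNReal.toReal_ofReal (by linarith [hϑ.2])]
  simp only [smul_eq_mul]
  ring

lemma meas_Ang3 {d : ℕ} : Measurable
    (fun z : EuclideanSpace ℝ (Fin d) × EuclideanSpace ℝ (Fin d) × EuclideanSpace ℝ (Fin d) => Ang (z.2.1 - z.1) (z.2.2 - z.1)) := by
  unfold Ang
  refine Real.continuous_arccos.measurable.comp (Measurable.div ?_ (Measurable.mul ?_ ?_))
  · exact Measurable.inner (by fun_prop) (by fun_prop)
  · exact Measurable.norm (by fun_prop)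
  · exact Measurable.norm (by fun_prop)

lemma integrable_Ang3 {d : ℕ} (M : Measure (EuclideanSpace ℝ (Fin d) × EuclideanSpace ℝ (Fin d) × EuclideanSpace ℝ (Fin d))) [IsFiniteMeasure M] :
    Integrable
    (fun z : EuclideanSpace ℝ (Fin d) × EuclideanSpace ℝ (Fin d) × EuclideanSpace ℝ (Fin d) => Ang (z.2.1 - z.1) (z.2.2 - z.1)) M := by
  refine Integrable.of_bound meas_Ang3.aestronglyMeasurable π ?_
  refine Filter.Eventually.of_forall fun z => ?_
  rw [Ang, Real.norm_eq_abs, abs_of_nonneg (Real.arccos_nonneg _)]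
  exact Real.arccos_le_pi _

lemma avg {d : ℕ} (P Q : Measure (EuclideanSpace ℝ (Fin d)))
    [IsProbabilityMeasure P] [IsProbabilityMeasure Q] [NullSingletonClass P] :
    Integrable (fun β => ∫ t, projCDF P β t ^ 2 ∂(projLaw Q β)) (sphereUniform d) ∧
    ∫ β, (∫ t, projCDF P β t ^ 2 ∂(projLaw Q β)) ∂(sphereUniform d)
      = 1 / 2 - 1 / (2 * π) * ∫ x1, ∫ x2, ∫ y, Ang (x1 - y) (x2 - y) ∂Q ∂P ∂P := by
  let S : Set (EuclideanSpace ℝ (Fin d) × (EuclideanSpace ℝ (Fin d) × EuclideanSpace ℝ (Fin d) × EuclideanSpace ℝ (Fin d))) :=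
    {w | ⟪w.1, w.2.2.1 - w.2.1⟫ ≤ 0} ∩ {w | ⟪w.1, w.2.2.2 - w.2.1⟫ ≤ 0}
  have hS : MeasurableSet S := (measurableSet_le (by fun_prop) (by fun_prop)).inter
    (measurableSet_le (by fun_prop) (by fun_prop))
  let M := Q.prod (P.prod P)
  let f : EuclideanSpace ℝ (Fin d) → (EuclideanSpace ℝ (Fin d) × EuclideanSpace ℝ (Fin d) × EuclideanSpace ℝ (Fin d)) → ℝ := fun β z => S.indicator 1 (β, z)
  have hf : Integrable (Function.uncurry f) ((sphereUniform d).prod M) := by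
    have : Function.uncurry f = S.indicator 1 := by ext ⟨a, b⟩; rfl
    rw [this]
    exact (integrable_const (1 : ℝ)).indicator hS
  have hA : ∀ β, ∫ z, f β z ∂M = ∫ t, projCDF P β t ^ 2 ∂(projLaw Q β) := by
    intro β
    have hSβ : MeasurableSet (Prod.mk β ⁻¹' S) := hS.preimage (by fun_prop)
    have h1 : ∫ z, f β z ∂M = M.real (Prod.mk β ⁻¹' S) := by
      rw [← integral_indicator_one hSβ]; rfl
    have h2 : M (Prod.mk β ⁻¹' S)
        = ∫⁻ y, (projLaw P β) (Set.Iic ⟪β, y⟫) * (projLaw P β) (Set.Iic ⟪β, y⟫) ∂Q := by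
      rw [Measure.prod_apply hSβ]
      congr with y
      rw [projLaw, Measure.map_apply (by fun_prop) measurableSet_Iic, ← Measure.prod_prod]
      congr 1
      ext z
      simp [S, inner_sub_right]
    rw [h1, measureReal_def, h2, ← integral_toReal]
    · simp only [projCDF_eq]
      rw [show projLaw Q β = Q.map (fun x => ⟪β, x⟫) from rfl, integral_map (by fun_prop)
        ((meas_Iic_real _).pow_const 2).aestronglyMeasurable]
      simp [measureReal_def, pow_two]
    · exact (((meas_Iic _).mul (meas_Iic _)).comp
        (by fun_prop : Measurable fun y : EuclideanSpace ℝ (Fin d) => (⟪β, y⟫ : ℝ))).aemeasurable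
    · exact Filter.Eventually.of_forall fun t =>
          ENNReal.mul_lt_top (measure_lt_top _ _) (measure_lt_top _ _)
  constructor
  · refine hf.integral_prod_left.congr (Filter.Eventually.of_forall fun β => ?_)
    exact hA β
  simp only [← hA]
  rw [integral_integral_swap hf]
  have hB : ∀ᵐ z ∂M, ∫ β, f β z ∂(sphereUniform d)
      = 1 / 2 - 1 / (2 * π) * Ang (z.2.1 - z.1) (z.2.2 - z.1) := by
    filter_upwards [ae_ne_triple Q P P] with z ⟨h1, h2, _⟩
    rw [← sphere_wedge _ _ (sub_ne_zero.2 h1.symm) (sub_ne_zero.2 h2.symm)]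
    have hSz : MeasurableSet ((fun β => (β, z)) ⁻¹' S) := hS.preimage (by fun_prop)
    change ∫ β, ((fun β => (β, z)) ⁻¹' S).indicator 1 β ∂(sphereUniform d) = _
    rw [integral_indicator_one hSz]
    rfl
  rw [integral_congr_ae hB]
  have hAng : Integrable (fun z : EuclideanSpace ℝ (Fin d) × EuclideanSpace ℝ (Fin d) × EuclideanSpace ℝ (Fin d) => Ang (z.2.1 - z.1) (z.2.2 - z.1)) M := integrable_Ang3 M
  rw [integral_sub (integrable_const _) (hAng.const_mul _), integral_const_mul]
  have h4 : ∫ z, Ang (z.2.1 - z.1) (z.2.2 - z.1) ∂M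
      = ∫ x1, ∫ x2, ∫ y, Ang (x1 - y) (x2 - y) ∂Q ∂P ∂P := by
    have h5 := integral_prod_symm _ hAng
    have h6 := integral_prod _ hAng.integral_prod_right
    exact h5.trans h6
  rw [h4]
  simp

lemma nullSing {d : ℕ} (P : Measure (EuclideanSpace ℝ (Fin d))) (β : EuclideanSpace ℝ (Fin d))
    (hP : ∀ t : ℝ, projLaw P β {t} = 0) : NullSingletonClass P := by
  refine ⟨fun x => ?_⟩
  have h := hP ⟪β, x⟫
  rw [projLaw, Measure.map_apply (by fun_prop) (measurableSet_singleton _)] at h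
  exact measure_mono_null (by simp) h

/-- Closed-form expression, Theorem 2.1: under the continuity assumption,
for every weight `ϑ ∈ (0,1)`,
`W_d²(P,Q) = 1/3 - (1/(2π)) E[Ang(X₁-Y, X₂-Y)] - (1/(2π)) E[Ang(Y₁-X, Y₂-X)]`,
with `X₁, X₂ ~ P` and `Y₁, Y₂ ~ Q` independent.  In particular the right-hand side does not
depend on `ϑ`, so neither does `W_d²(P,Q)`. -/
theorem stmt2 {d : ℕ} (P Q : Measure (EuclideanSpace ℝ (Fin d)))
    [IsProbabilityMeasure P] [IsProbabilityMeasure Q]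
    (hc : ContinuityAssumption P Q) (ϑ : ℝ) (hϑ : ϑ ∈ Set.Ioo (0 : ℝ) 1) :
    cvmSq ϑ P Q
      = 1 / 3
        - (1 / (2 * π)) * (∫ x1, ∫ x2, ∫ y, Ang (x1 - y) (x2 - y) ∂Q ∂P ∂P)
        - (1 / (2 * π)) * (∫ y1, ∫ y2, ∫ x, Ang (y1 - x) (y2 - x) ∂P ∂Q ∂Q) := by
  obtain ⟨β, hβP, hβQ⟩ := hc.exists
  have := nullSing P β hβP
  have := nullSing Q β hβQ
  obtain ⟨i1, a1⟩ := avg P Q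
  obtain ⟨i2, a2⟩ := avg Q P
  have e : cvmSq ϑ P Q = ∫ β, (∫ t, projCDF P β t ^ 2 ∂(projLaw Q β)
      + ∫ t, projCDF Q β t ^ 2 ∂(projLaw P β) - 2 / 3) ∂(sphereUniform d) := by
    apply integral_congr_ae
    filter_upwards [hc] with β hβ
    exact inner_eq P Q ϑ hϑ β hβ.1 hβ.2
  rw [e, integral_sub (i1.fun_add i2) (integrable_const _), integral_add i1 i2, a1, a2]
  simp only [integral_const, probReal_univ, smul_eq_mul]
  ring
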